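/- Let T be a task that is learnable under fairness and let R be a converging fair run on T. A policy π occurring in R at the end of a trial is the final policy of R if and only if forward(π) ⊆ backward(π). -/

import Mathlib

/-!
Formalization of the navigational reinforcement learning framework of
Ameloot & Van den Bussche, "On the convergence of cycle detection for
navigational reinforcement learning".
-/

/-- A task `T = (Q, Q₀, A, rewards, δ)`: `Q` and `A` are (finite, nonempty) types,
`start` is a nonempty set of start states, `rewards` a nonempty set of
state-action pairs and `delta` maps each state-action pair to a nonempty
set of successor states. -/
structure NavTask (Q A : Type) where
  start : Set Q
  start_nonempty : start.Nonempty
  rewards : Set (Q × A)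
  rewards_nonempty : rewards.Nonempty
  delta : Q → A → Set Q
  delta_nonempty : ∀ q a, (delta q a).Nonempty

namespace NavTask

variable {Q A : Type}

/-- The goal states of a task. -/
def goals (T : NavTask Q A) : Set Q := {q | ∃ a, (q, a) ∈ T.rewards}

/-- The reducibility layers relative to a set `S`; `layers S 0` is the layer `F₁ = S`
of the paper, and `layers S n` is the layer `F_{n+1}`. -/
def layers (T : NavTask Q A) (S : Set Q) : ℕ → Set Q
  | 0 => S
  | n + 1 => T.layers S n ∪ {q | ∃ a, T.delta q a ⊆ T.layers S n}

/-- `S'` is reducible to `S`. -/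
def ReducibleTo (T : NavTask Q A) (S' S : Set Q) : Prop := S' ⊆ ⋃ n, T.layers S n

/-- `reduce T`: the set of states reducible to the goal states. -/
def reduce (T : NavTask Q A) : Set Q := ⋃ n, T.layers T.goals n

/-- A task is reducible if all states are reducible to the goal states. -/
def Reducible (T : NavTask Q A) : Prop := T.ReducibleTo Set.univ T.goals

end NavTask

/-- A configuration `(q, π, V)`: current state, policy, working memory. -/
structure Config (Q A : Type) where
  state : Q
  pol : Q → A
  mem : Set Q

namespace Config

variable {Q A : Type}

/-- A configuration is branching if its current state has already been visited. -/
def Branching (c : Config Q A) : Prop := c.state ∈ c.mem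

/-- Applying an option `(a, q')` to a configuration: move to `q'`, record action `a`
for the departed state, and mark the departed state as visited. -/
noncomputable def apply (c : Config Q A) (a : A) (q' : Q) : Config Q A :=
  letI := Classical.decEq Q
  ⟨q', Function.update c.pol c.state a, c.mem ∪ {c.state}⟩

end Config

/-- A transition: a four-tuple (source configuration, action, chosen successor
state, target configuration). -/
structure Step (Q A : Type) where
  src : Config Q A
  act : A
  nxt : Q
  tgt : Config Q A

namespace NavTask

variable {Q A : Type}

/-- The options of a configuration: all actions if branching, otherwise only
the action given by the policy, paired with possible successor states. -/
def opts (T : NavTask Q A) (c : Config Q A) : Set (A × Q) :=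
  {p | (c.Branching ∨ p.1 = c.pol c.state) ∧ p.2 ∈ T.delta c.state p.1}

/-- Validity of a transition. -/
def ValidStep (T : NavTask Q A) (t : Step Q A) : Prop :=
  (t.act, t.nxt) ∈ T.opts t.src ∧ t.tgt = t.src.apply t.act t.nxt

/-- A reward transition. -/
def IsRewardStep (T : NavTask Q A) (t : Step Q A) : Prop :=
  (t.src.state, t.act) ∈ T.rewards

end NavTask

/-- A finite list of transitions is a chain: each target is the next source. -/
def IsChainList {Q A : Type} (l : List (Step Q A)) : Prop :=
  ∀ i (h : i + 1 < l.length),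
    (l[i]'(Nat.lt_of_succ_lt h)).tgt = (l[i + 1]'h).src

/-- The first (source) configuration of a finite chain, if any. -/
def firstSrc? {Q A : Type} (l : List (Step Q A)) : Option (Config Q A) :=
  l.head?.map Step.src

/-- The last (target, i.e. terminal) configuration of a finite chain, if any. -/
def lastTgt? {Q A : Type} (l : List (Step Q A)) : Option (Config Q A) :=
  l.getLast?.map Step.tgt

namespace NavTask

variable {Q A : Type}

/-- A finite trial: a nonempty valid chain ending with a reward transition and
containing no other reward transitions. -/
def IsFinTrial (T : NavTask Q A) (l : List (Step Q A)) : Prop :=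
  l ≠ [] ∧ IsChainList l ∧ (∀ t ∈ l, T.ValidStep t) ∧
  (∀ t ∈ l.getLast?, T.IsRewardStep t) ∧
  (∀ i (h : i + 1 < l.length), ¬ T.IsRewardStep (l[i]'(Nat.lt_of_succ_lt h)))

/-- An infinite trial: an infinite valid chain with no reward transitions. -/
def IsInfTrial (T : NavTask Q A) (g : ℕ → Step Q A) : Prop :=
  (∀ n, T.ValidStep (g n)) ∧ (∀ n, (g n).tgt = (g (n + 1)).src) ∧
  (∀ n, ¬ T.IsRewardStep (g n))

/-- A start configuration: a start state with empty working memory. -/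
def IsStartConfig (T : NavTask Q A) (c : Config Q A) : Prop :=
  c.state ∈ T.start ∧ c.mem = ∅

/-- When a trial ends with `c₁`, the next trial starts with a configuration `c₂`
whose state is a start state, with the same policy, and empty working memory. -/
def Succession (T : NavTask Q A) (c₁ c₂ : Config Q A) : Prop :=
  c₂.state ∈ T.start ∧ c₂.pol = c₁.pol ∧ c₂.mem = ∅

end NavTask

/-- A trial is either a finite or an infinite chain of transitions. -/
inductive Trial (Q A : Type) where
  | fin : List (Step Q A) → Trial Q A
  | inf : (ℕ → Step Q A) → Trial Q A

namespace Trial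

variable {Q A : Type}

/-- A trial is finite (terminates). -/
def IsFinite : Trial Q A → Prop
  | .fin _ => True
  | .inf _ => False

/-- The configuration occurring at (0-based) position `n` of a trial: sources of
the transitions, plus (for a finite trial) the terminal configuration. -/
def config? : Trial Q A → ℕ → Option (Config Q A)
  | .fin l, n =>
      if h : n < l.length then some (l[n]'h).src
      else if n = l.length then lastTgt? l else none
  | .inf g, n => some (g n).src

/-- Position `n` of a trial is non-terminal. -/
def NonTerminal : Trial Q A → ℕ → Prop
  | .fin l, n => n < l.length
  | .inf _, _ => True

/-- The positions at which state `q` occurs in a trial. -/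
def stateOccs (tr : Trial Q A) (q : Q) : Set ℕ :=
  {n | ∃ c ∈ tr.config? n, c.state = q}

end Trial

/-- Validity of a trial. -/
def NavTask.IsTrial {Q A : Type} (T : NavTask Q A) : Trial Q A → Prop
  | .fin l => T.IsFinTrial l
  | .inf g => T.IsInfTrial g

/-- A run: either an infinite sequence of finite trials, or finitely many finite
trials followed by one infinite trial. -/
inductive Run (Q A : Type) where
  | allFin : (ℕ → List (Step Q A)) → Run Q A
  | withInf : List (List (Step Q A)) → (ℕ → Step Q A) → Run Q A

/-- Validity of a run on a task. -/
def NavTask.IsRun {Q A : Type} (T : NavTask Q A) : Run Q A → Prop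
  | .allFin f =>
      (∀ n, T.IsFinTrial (f n)) ∧
      (∀ c ∈ firstSrc? (f 0), T.IsStartConfig c) ∧
      (∀ n, ∀ c₁ ∈ lastTgt? (f n), ∀ c₂ ∈ firstSrc? (f (n + 1)), T.Succession c₁ c₂) ∧
      (∀ q ∈ T.start, {n | ∃ c ∈ firstSrc? (f n), c.state = q}.Infinite)
  | .withInf L g =>
      (∀ l ∈ L, T.IsFinTrial l) ∧ T.IsInfTrial g ∧
      (L = [] → T.IsStartConfig (g 0).src) ∧
      (∀ l ∈ L.head?, ∀ c ∈ firstSrc? l, T.IsStartConfig c) ∧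
      (∀ i (h : i + 1 < L.length),
        ∀ c₁ ∈ lastTgt? (L[i]'(Nat.lt_of_succ_lt h)),
        ∀ c₂ ∈ firstSrc? (L[i + 1]'h), T.Succession c₁ c₂) ∧
      (∀ c₁ ∈ lastTgt? (L.getLast?.getD []), T.Succession c₁ (g 0).src)

namespace Run

variable {Q A : Type}

/-- The trials of a run. -/
def trials : Run Q A → Set (Trial Q A)
  | .allFin f => {tr | ∃ n, tr = .fin (f n)}
  | .withInf L g => {tr | (∃ l ∈ L, tr = .fin l) ∨ tr = .inf g}

/-- `P` holds at infinitely many transitions (equivalently, non-terminal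
configuration occurrences) of the run, restricted to trials of index `≥ i`. -/
def InfOftenFrom : Run Q A → ℕ → (Step Q A → Prop) → Prop
  | .allFin f, i, P =>
      {p : ℕ × ℕ | i ≤ p.1 ∧ ∃ h : p.2 < (f p.1).length, P ((f p.1)[p.2]'h)}.Infinite
  | .withInf L g, i, P => i ≤ L.length ∧ {n | P (g n)}.Infinite

/-- `P` holds at infinitely many transitions of the run. -/
def InfOften (R : Run Q A) (P : Step Q A → Prop) : Prop := R.InfOftenFrom 0 P

/-- A state is stable: only finitely many non-terminal occurrences of branching
configurations containing it. -/
def Stable (R : Run Q A) (q : Q) : Prop :=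
  ¬ R.InfOften (fun t => t.src.state = q ∧ t.src.Branching)

/-- All trials of the run are finite. -/
def AllFinite : Run Q A → Prop
  | .allFin _ => True
  | .withInf _ _ => False

/-- A run converges: all trials terminate (with reward) and every state
eventually becomes stable. -/
def Converges (R : Run Q A) : Prop := R.AllFinite ∧ ∀ q, R.Stable q

/-- Only finitely many trials contain more than `k` non-terminal configurations;
equivalently, from some trial index on, every trial has at most `k`
non-terminal configurations (sources of transitions). -/
def EventuallyBounded : Run Q A → ℕ → Prop
  | .allFin f, k => {n | k < (f n).length}.Finite
  | .withInf _ _, _ => False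

/-- After trial `i` there are no more branching configurations at
non-terminal positions. -/
def NoBranchingAfter : Run Q A → ℕ → Prop
  | .allFin f, i => ∀ m, i < m → ∀ t ∈ f m, ¬ t.src.Branching
  | .withInf L g, i =>
      (∀ m, i < m → ∀ l ∈ L[m]?, ∀ t ∈ l, ¬ t.src.Branching) ∧
      (i < L.length → ∀ n, ¬ (g n).src.Branching)

/-- Trial `i` of the run terminates (is finite). -/
def TrialTerminates : Run Q A → ℕ → Prop
  | .allFin _, _ => True
  | .withInf L _, i => i < L.length

/-- `i` is the convergence-trial index: the smallest trial index such that trial `i`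
terminates and after trial `i` there are no branching configurations at
non-terminal positions. -/
def IsConvIndex (R : Run Q A) (i : ℕ) : Prop :=
  R.TrialTerminates i ∧ R.NoBranchingAfter i ∧
  ∀ j < i, ¬ (R.TrialTerminates j ∧ R.NoBranchingAfter j)

/-- `π` is the policy at the end of trial `i` of the run. -/
def EndPolicyAt : Run Q A → ℕ → (Q → A) → Prop
  | .allFin f, i, π => ∃ t ∈ (f i).getLast?, t.tgt.pol = π
  | .withInf L _, i, π => ∃ l ∈ L[i]?, ∃ t ∈ l.getLast?, t.tgt.pol = π

/-- `π` is the final policy of the run: the policy at the end of the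
convergence-trial. -/
def IsFinalPolicy (R : Run Q A) (π : Q → A) : Prop :=
  ∃ i, R.IsConvIndex i ∧ R.EndPolicyAt i π

/-- `π` occurs in the run at the end of some trial. -/
def EndsPolicy (R : Run Q A) (π : Q → A) : Prop := ∃ i, R.EndPolicyAt i π

end Run

namespace NavTask

variable {Q A : Type}

/-- Fairness: every configuration occurring infinitely often at non-terminal
positions has each of its options taken infinitely often. -/
def Fair (T : NavTask Q A) (R : Run Q A) : Prop :=
  ∀ c : Config Q A, R.InfOften (fun t => t.src = c) →
    ∀ p ∈ T.opts c,
      R.InfOften (fun t => t = ⟨c, p.1, p.2, c.apply p.1 p.2⟩)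

/-- A task is learnable under fairness if every fair run on it converges. -/
def Learnable (T : NavTask Q A) : Prop :=
  ∀ R : Run Q A, T.IsRun R → T.Fair R → R.Converges

/-- `ground π`: goal states assigned a rewarding action by the policy. -/
def ground (T : NavTask Q A) (π : Q → A) : Set Q := {q | (q, π q) ∈ T.rewards}

/-- The forward layers of a policy; `fwd π 0` is `F₁ = Q₀` of the paper. -/
def fwd (T : NavTask Q A) (π : Q → A) : ℕ → Set Q
  | 0 => T.start
  | n + 1 => T.fwd π n ∪ ⋃ q ∈ T.fwd π n \ T.ground π, T.delta q (π q)

/-- `forward π`: states reachable from the start states by following `π`. -/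
def forward (T : NavTask Q A) (π : Q → A) : Set Q := ⋃ n, T.fwd π n

/-- The backward layers of a policy; `bwd π 0` is `B₁ = ground(π)` of the paper. -/
def bwd (T : NavTask Q A) (π : Q → A) : ℕ → Set Q
  | 0 => T.ground π
  | n + 1 => T.bwd π n ∪ {q | T.delta q (π q) ⊆ T.bwd π n}

/-- `backward π`: states reduced by `π` to the goal states in `ground π`. -/
def backward (T : NavTask Q A) (π : Q → A) : Set Q := ⋃ n, T.bwd π n

/-- A (simple) path from `q` to `q'`: non-reward transitions, pairwise distinct
states. -/
def Path (T : NavTask Q A) (q q' : Q) : Prop :=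
  ∃ (n : ℕ) (s : ℕ → Q) (a : ℕ → A),
    s 0 = q ∧ s n = q' ∧
    (∀ i < n, s (i + 1) ∈ T.delta (s i) (a i)) ∧
    (∀ i < n, (s i, a i) ∉ T.rewards) ∧
    (∀ i ≤ n, ∀ j ≤ n, i ≠ j → s i ≠ s j)

/-- A state is reachable: there is a path from some start state to it. -/
def Reachable (T : NavTask Q A) (q : Q) : Prop := ∃ q₀ ∈ T.start, T.Path q₀ q

/-- A state has a path to a set `S`. -/
def HasPathTo (T : NavTask Q A) (q : Q) (S : Set Q) : Prop := ∃ q' ∈ S, T.Path q q'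

end NavTask

namespace Config

variable {Q A : Type}

theorem apply_pol_self (c : Config Q A) (q' : Q) :
    (c.apply (c.pol c.state) q').pol = c.pol := by
  simp [Config.apply]

end Config

namespace NavTask

variable {Q A : Type} {T : NavTask Q A} {π : Q → A} {l : List (Step Q A)}

theorem ValidStep.act_eq {t : Step Q A} (ht : T.ValidStep t) (hb : ¬ t.src.Branching) :
    t.act = t.src.pol t.src.state :=
  ht.1.1.resolve_left hb

theorem ValidStep.tgt_pol_eq {t : Step Q A} (ht : T.ValidStep t) (hb : ¬ t.src.Branching) :
    t.tgt.pol = t.src.pol := by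
  rw [ht.2, ht.act_eq hb, Config.apply_pol_self]

theorem forward_subset_of_closed {S : Set Q} (hstart : T.start ⊆ S)
    (hstep : ∀ q ∈ S, q ∉ T.ground π → T.delta q (π q) ⊆ S) : T.forward π ⊆ S := by
  refine Set.iUnion_subset fun n => ?_
  induction n with
  | zero => exact hstart
  | succ n ih =>
    exact Set.union_subset ih (Set.iUnion₂_subset fun q hq => hstep q (ih hq.1) hq.2)

theorem start_subset_forward : T.start ⊆ T.forward π :=
  Set.subset_iUnion (T.fwd π) 0

theorem delta_subset_forward {q : Q} (hq : q ∈ T.forward π) (hg : q ∉ T.ground π) :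
    T.delta q (π q) ⊆ T.forward π := by
  obtain ⟨n, hn⟩ := Set.mem_iUnion.1 hq
  intro q' hq'
  exact Set.mem_iUnion.2 ⟨n + 1, Or.inr (Set.mem_iUnion₂.2 ⟨q, ⟨hn, hg⟩, hq'⟩)⟩

theorem ground_subset_backward : T.ground π ⊆ T.backward π :=
  Set.subset_iUnion (T.bwd π) 0

theorem bwd_mono : Monotone (T.bwd π) :=
  monotone_nat_of_le_succ fun _ => Set.subset_union_left

theorem mem_backward_of_delta_subset [Finite Q] {q : Q}
    (h : T.delta q (π q) ⊆ T.backward π) : q ∈ T.backward π := by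
  lift T.delta q (π q) to Finset Q using Set.toFinite _ with s hs
  obtain ⟨n, hn⟩ := Directed.exists_mem_subset_of_finset_subset_biUnion
    (bwd_mono (T := T) (π := π)).directed_le h
  rw [hs] at hn
  exact Set.mem_iUnion.2 ⟨n + 1, Or.inr hn⟩

theorem exists_lt_mem_bwd {q q' : Q} (hg : q ∉ T.ground π) (hq' : q' ∈ T.delta q (π q))
    {n : ℕ} (hq : q ∈ T.bwd π n) : ∃ m < n, q' ∈ T.bwd π m := by
  induction n with
  | zero => exact absurd hq hg
  | succ n ih =>
    rcases hq with hq | hq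
    · obtain ⟨m, hm, h⟩ := ih hq
      exact ⟨m, by omega, h⟩
    · exact ⟨n, by omega, hq hq'⟩

theorem IsFinTrial.src_pol_eq (hl : T.IsFinTrial l) (hb : ∀ t ∈ l, ¬ t.src.Branching)
    (h0 : ∀ c ∈ firstSrc? l, c.pol = π) :
    ∀ k (h : k < l.length), (l[k]).src.pol = π := by
  intro k
  induction k with
  | zero =>
    intro h
    exact h0 _ (by simp [firstSrc?, List.head?_eq_getElem?, List.getElem?_eq_getElem h])
  | succ k ih =>
    intro h
    have hk : k < l.length := Nat.lt_of_succ_lt h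
    rw [← hl.2.1 k h, (hl.2.2.1 _ (List.getElem_mem hk)).tgt_pol_eq
      (hb _ (List.getElem_mem hk)), ih hk]

theorem IsFinTrial.lastTgt_pol_eq (hl : T.IsFinTrial l) (hb : ∀ t ∈ l, ¬ t.src.Branching)
    (h0 : ∀ c ∈ firstSrc? l, c.pol = π) : ∀ c ∈ lastTgt? l, c.pol = π := by
  intro c hc
  obtain ⟨t, ht, rfl⟩ := Option.mem_map.1 hc
  have hmem := List.mem_of_mem_getLast? ht
  obtain ⟨k, hk, rfl⟩ := List.getElem_of_mem hmem
  rw [(hl.2.2.1 _ hmem).tgt_pol_eq (hb _ hmem), hl.src_pol_eq hb h0 k hk]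

/-- A trial that starts from a start state, with empty memory and a policy whose forward
states are all backward states, follows that policy and revisits no state. -/
theorem IsFinTrial.not_branching_of_forward_subset_backward (hl : T.IsFinTrial l)
    (hsub : T.forward π ⊆ T.backward π)
    (h0 : ∀ c ∈ firstSrc? l, c.state ∈ T.start ∧ c.pol = π ∧ c.mem = ∅) :
    ∀ t ∈ l, ¬ t.src.Branching := by
  have hnb : ∀ c : Config Q A, c.state ∈ T.forward π →
      (∀ v ∈ c.mem, ∀ n, v ∈ T.bwd π n → ∃ m < n, c.state ∈ T.bwd π m) →
      ¬ c.Branching := by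
    intro c hc hrank hb
    obtain ⟨n, hn⟩ := Set.mem_iUnion.1 (hsub hc)
    induction n using Nat.strong_induction_on with
    | _ n ih =>
      obtain ⟨m, hm, h⟩ := hrank _ hb n hn
      exact ih m hm h
  have key : ∀ k (h : k < l.length), (l[k]).src.pol = π ∧ (l[k]).src.state ∈ T.forward π ∧
      ∀ v ∈ (l[k]).src.mem, ∀ n, v ∈ T.bwd π n → ∃ m < n, (l[k]).src.state ∈ T.bwd π m := by
    intro k
    induction k with
    | zero =>
      intro h
      obtain ⟨hs, hp, hm⟩ := h0 (l[0]).src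
        (by simp [firstSrc?, List.head?_eq_getElem?, List.getElem?_eq_getElem h])
      exact ⟨hp, start_subset_forward hs, by simp [hm]⟩
    | succ k ih =>
      intro h
      have hk : k < l.length := Nat.lt_of_succ_lt h
      obtain ⟨hp, hf, hr⟩ := ih hk
      have hv := hl.2.2.1 _ (List.getElem_mem hk)
      have hb := hnb _ hf hr
      have hact := hv.act_eq hb
      have hg : (l[k]).src.state ∉ T.ground π := by
        have := hl.2.2.2.2 k h
        rwa [IsRewardStep, hact, hp] at this
      have hd : (l[k]).nxt ∈ T.delta (l[k]).src.state (π (l[k]).src.state) := by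
        have := hv.1.2
        rwa [hact, hp] at this
      rw [← hl.2.1 k h]
      refine ⟨(hv.tgt_pol_eq hb).trans hp, ?_, ?_⟩
      · rw [hv.2]
        exact delta_subset_forward hf hg hd
      · rw [hv.2]
        rintro v (hvm | rfl) n hn
        · obtain ⟨m, hm, h'⟩ := hr v hvm n hn
          obtain ⟨m', hm', h''⟩ := exists_lt_mem_bwd hg hd h'
          exact ⟨m', hm'.trans hm, h''⟩
        · exact exists_lt_mem_bwd hg hd hn
  intro t ht
  obtain ⟨k, hk, rfl⟩ := List.getElem_of_mem ht
  exact hnb _ (key k hk).2.1 (key k hk).2.2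

end NavTask

namespace Run

variable {Q A : Type} {T : NavTask Q A} {π : Q → A} {f : ℕ → List (Step Q A)}

theorem InfOften.exists_after {P : Step Q A → Prop} (h : (Run.allFin f).InfOften P) (i : ℕ) :
    ∃ n > i, ∃ t ∈ f n, P t := by
  by_contra! hcon
  refine h (((Set.finite_Iic i).biUnion fun n _ =>
    (Set.finite_singleton n).prod (Set.finite_Iio (f n).length)).subset ?_)
  rintro ⟨n, k⟩ ⟨-, hk, hP⟩
  have hn : n ≤ i := by
    by_contra hn
    exact hcon n (by omega) _ (List.getElem_mem hk) hP
  exact Set.mem_iUnion₂.2 ⟨n, hn, rfl, hk⟩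

theorem InfOften.tgt (hrun : T.IsRun (.allFin f)) {t : Step Q A} (ht : ¬ T.IsRewardStep t)
    (h : (Run.allFin f).InfOften (fun s => s = t)) :
    (Run.allFin f).InfOften (fun s => s.src = t.tgt) := by
  have hinj : Function.Injective (fun p : ℕ × ℕ => (p.1, p.2 + 1)) := by
    rintro ⟨a, b⟩ ⟨c, d⟩ h
    simpa using h
  refine (Set.Infinite.image hinj.injOn h).mono ?_
  rintro _ ⟨⟨n, k⟩, ⟨-, hk, hP⟩, rfl⟩
  have hfin := hrun.1 n
  have hk' : k + 1 < (f n).length := by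
    by_contra hlast
    refine ht (hP ▸ hfin.2.2.2.1 _ ?_)
    have : k = (f n).length - 1 := by simp only at hk; omega
    subst this
    simp only at hk ⊢
    rw [List.getLast?_eq_getElem?, List.getElem?_eq_getElem hk]
    rfl
  exact ⟨Nat.zero_le _, hk', (hfin.2.1 k hk').symm.trans (congrArg Step.tgt hP)⟩

theorem firstSrc_pol_of_endPolicyAt (hrun : T.IsRun (.allFin f)) {n : ℕ}
    (h : (Run.allFin f).EndPolicyAt n π) :
    ∀ c ∈ firstSrc? (f (n + 1)), c.state ∈ T.start ∧ c.pol = π ∧ c.mem = ∅ := by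
  obtain ⟨t, ht, rfl⟩ := h
  exact fun c hc => hrun.2.2.1 n _ (Option.mem_map.2 ⟨t, ht, rfl⟩) c hc

theorem endPolicyAt_of_lastTgt (hrun : T.IsRun (.allFin f)) {n : ℕ}
    (h : ∀ c ∈ lastTgt? (f n), c.pol = π) : (Run.allFin f).EndPolicyAt n π := by
  have hne := (hrun.1 n).1
  have hlast := List.getLast?_eq_some_getLast hne
  exact ⟨_, hlast, h _ (Option.mem_map.2 ⟨_, hlast, rfl⟩)⟩

theorem EndPolicyAt.of_noBranchingAfter (hrun : T.IsRun (.allFin f)) {i : ℕ}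
    (hi : (Run.allFin f).NoBranchingAfter i) (h : (Run.allFin f).EndPolicyAt i π) {n : ℕ}
    (hn : i ≤ n) : (Run.allFin f).EndPolicyAt n π := by
  induction n, hn using Nat.le_induction with
  | base => exact h
  | succ n hn ih =>
    exact endPolicyAt_of_lastTgt hrun ((hrun.1 _).lastTgt_pol_eq (hi _ (by omega))
      fun c hc => (firstSrc_pol_of_endPolicyAt hrun ih c hc).2.1)

theorem EndPolicyAt.unique {n : ℕ} {π' : Q → A} (h : (Run.allFin f).EndPolicyAt n π)
    (h' : (Run.allFin f).EndPolicyAt n π') : π = π' := by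
  obtain ⟨t, ht, rfl⟩ := h
  obtain ⟨t', ht', rfl⟩ := h'
  rw [Option.mem_unique ht ht']

theorem noBranchingAfter_of_forward_subset_backward (hrun : T.IsRun (.allFin f)) {j : ℕ}
    (h : (Run.allFin f).EndPolicyAt j π) (hsub : T.forward π ⊆ T.backward π) :
    (Run.allFin f).NoBranchingAfter j := by
  have key : ∀ n ≥ j, (Run.allFin f).EndPolicyAt n π := by
    intro n hn
    induction n, hn using Nat.le_induction with
    | base => exact h
    | succ n hn ih =>
      have h0 := firstSrc_pol_of_endPolicyAt hrun ih
      exact endPolicyAt_of_lastTgt hrun ((hrun.1 _).lastTgt_pol_eq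
        ((hrun.1 _).not_branching_of_forward_subset_backward hsub h0) fun c hc => (h0 c hc).2.1)
  intro m hm
  obtain ⟨n, rfl⟩ : ∃ n, m = n + 1 := ⟨m - 1, by omega⟩
  exact (hrun.1 _).not_branching_of_forward_subset_backward hsub
    (firstSrc_pol_of_endPolicyAt hrun (key n (by omega)))

theorem infOften_start (hrun : T.IsRun (.allFin f)) {i : ℕ}
    (hi : (Run.allFin f).NoBranchingAfter i) (h : (Run.allFin f).EndPolicyAt i π)
    {q : Q} (hq : q ∈ T.start) :
    (Run.allFin f).InfOften (fun t => t.src = ⟨q, π, ∅⟩) := by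
  have hinj : Function.Injective (fun n : ℕ => (n, 0)) := fun a b h => by simpa using h
  refine (Set.Infinite.image hinj.injOn
    ((hrun.2.2.2 q hq).sdiff (Set.finite_Iic i))).mono ?_
  rintro _ ⟨m, ⟨⟨c, hc, rfl⟩, hm⟩, rfl⟩
  rw [Set.mem_Iic, not_le] at hm
  obtain ⟨n, rfl⟩ : ∃ n, m = n + 1 := ⟨m - 1, by omega⟩
  obtain ⟨-, hp, hmem⟩ :=
    firstSrc_pol_of_endPolicyAt hrun (h.of_noBranchingAfter hrun hi (n := n) (by omega)) c hc
  have hlen := List.length_pos_of_ne_nil (hrun.1 (n + 1)).1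
  refine ⟨Nat.zero_le _, hlen, ?_⟩
  simp only [firstSrc?, List.head?_eq_getElem?, List.getElem?_eq_getElem hlen, Option.map_some,
    Option.mem_some_iff] at hc
  subst hc
  rw [← hp, ← hmem]

theorem infOften_succ (hrun : T.IsRun (.allFin f)) (hfair : T.Fair (.allFin f))
    {q q' : Q} {V : Set Q} (hg : q ∉ T.ground π) (hq' : q' ∈ T.delta q (π q))
    (h : (Run.allFin f).InfOften (fun t => t.src = ⟨q, π, V⟩)) :
    (Run.allFin f).InfOften (fun t => t.src = ⟨q', π, V ∪ {q}⟩) := by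
  have := InfOften.tgt hrun (by exact hg) (hfair _ h (π q, q') ⟨Or.inr rfl, hq'⟩)
  simpa [Config.apply] using this

theorem forward_subset_backward [Finite Q] (hrun : T.IsRun (.allFin f))
    (hfair : T.Fair (.allFin f)) {i : ℕ} (hi : (Run.allFin f).NoBranchingAfter i)
    (h : (Run.allFin f).EndPolicyAt i π) : T.forward π ⊆ T.backward π := by
  have hback : ∀ n (q : Q) (V : Set Q), Vᶜ.ncard = n →
      (Run.allFin f).InfOften (fun t => t.src = ⟨q, π, V⟩) → q ∈ T.backward π := by
    intro n
    induction n using Nat.strong_induction_on with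
    | _ n ih =>
      rintro q V rfl hinf
      by_cases hg : q ∈ T.ground π
      · exact NavTask.ground_subset_backward hg
      have hqV : q ∉ V := by
        obtain ⟨m, hm, t, ht, hsrc⟩ := hinf.exists_after i
        have := hi m hm t ht
        rwa [hsrc] at this
      refine NavTask.mem_backward_of_delta_subset fun q' hq' =>
        ih _ ?_ q' (V ∪ {q}) rfl (infOften_succ hrun hfair hg hq' hinf)
      exact Set.ncard_lt_ncard ⟨Set.compl_subset_compl.2 Set.subset_union_left,
        fun hsub => hsub (show q ∈ Vᶜ from hqV) (Or.inr rfl)⟩ (Set.toFinite _)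
  have hocc : T.forward π ⊆
      {q | ∃ V, (Run.allFin f).InfOften (fun t => t.src = ⟨q, π, V⟩)} :=
    NavTask.forward_subset_of_closed (fun q hq => ⟨∅, infOften_start hrun hi h hq⟩)
      fun q ⟨V, hV⟩ hg q' hq' => ⟨_, infOften_succ hrun hfair hg hq' hV⟩
  intro q hq
  obtain ⟨V, hV⟩ := hocc hq
  exact hback _ q V rfl hV

end Run

/-- For a task learnable under fairness and a converging fair run,
a policy occurring at the end of a trial is the final policy iff
`forward(π) ⊆ backward(π)`. -/
theorem final_policy_characterization {Q A : Type} [Fintype Q] [Fintype A]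
    (T : NavTask Q A) (hlearn : T.Learnable)
    (R : Run Q A) (hrun : T.IsRun R) (hfair : T.Fair R) (hconv : R.Converges)
    (π : Q → A) (hend : R.EndsPolicy π) :
    R.IsFinalPolicy π ↔ T.forward π ⊆ T.backward π := by
  classical
  cases R with
  | withInf L g => exact hconv.1.elim
  | allFin f =>
    constructor
    · rintro ⟨i, hi, hpol⟩
      exact Run.forward_subset_backward hrun hfair hi.2.1 hpol
    · intro hsub
      obtain ⟨j, hj⟩ := hend
      have hex : ∃ i, (Run.allFin f).TrialTerminates i ∧ (Run.allFin f).NoBranchingAfter i :=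
        ⟨j, trivial, Run.noBranchingAfter_of_forward_subset_backward hrun hj hsub⟩
      have hspec := Nat.find_spec hex
      refine ⟨Nat.find hex, ⟨hspec.1, hspec.2, fun k hk => Nat.find_min hex hk⟩, ?_⟩
      have hlast : (Run.allFin f).EndPolicyAt (Nat.find hex)
          ((f (Nat.find hex)).getLast (hrun.1 _).1).tgt.pol :=
        ⟨_, List.getLast?_eq_some_getLast _, rfl⟩
      have hle : Nat.find hex ≤ j := Nat.find_min' hex
        ⟨trivial, Run.noBranchingAfter_of_forward_subset_backward hrun hj hsub⟩
      rwa [(hlast.of_noBranchingAfter hrun hspec.2 hle).unique hj] at hlast
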